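/- arXiv:1306.4163 — 3 statements merged into one kernel-verified Lean document; each statement's English description precedes it below -/
import Mathlib

section
/- Let (a_n)_{n≥1} be a sequence of real numbers, let c > 0, let 0 < η < 1/32, and let K > 0 be such that |Σ_{n≤x} a_n² − c·x| ≤ K·x^{31/32 + η} for every real x ≥ 2. Then there exist C > 0 and x₀ ≥ 2 such that for every real x ≥ x₀ there is an integer n with x ≤ n ≤ x + C·x^{31/32 + η} and a_n ≠ 0. -/
open Filter Topology

theorem stmt3 (a : ℕ → ℝ) (c η K : ℝ) (hc : 0 < c) (hη1 : 0 < η)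
    (hη2 : η < 1 / 32) (hK : 0 < K)
    (h : ∀ x : ℝ, 2 ≤ x →
      |(∑ n ∈ Finset.Icc 1 ⌊x⌋₊, (a n) ^ 2) - c * x| ≤ K * x ^ (31 / 32 + η)) :
    ∃ C x₀ : ℝ, 0 < C ∧ 2 ≤ x₀ ∧ ∀ x : ℝ, x₀ ≤ x →
      ∃ n : ℕ, x ≤ (n : ℝ) ∧ (n : ℝ) ≤ x + C * x ^ (31 / 32 + η) ∧ a n ≠ 0 := by
  obtain ⟨C, hC⟩ : ∃ C : ℝ, C = 4 * K / c := ⟨_, rfl⟩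
  have hC0 : 0 < C := by rw [hC]; positivity
  have hcC : c * C = 4 * K := by rw [hC]; field_simp
  obtain ⟨θ, hθ⟩ : ∃ θ : ℝ, θ = 31 / 32 + η := ⟨_, rfl⟩
  rw [← hθ] at h ⊢
  have hθ0 : 0 ≤ θ := by linarith
  have hθ1 : θ < 1 := by linarith
  obtain ⟨B, hB⟩ := eventually_atTop.mp
    ((tendsto_rpow_atTop (sub_pos.mpr hθ1)).eventually_ge_atTop C)
  refine ⟨C, max B 2, hC0, le_max_right _ _, fun x hx => ?_⟩
  have hx2 : 2 ≤ x := (le_max_right _ _).trans hx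
  have hx0 : 0 < x := by linarith
  have hpow : 0 < x ^ θ := Real.rpow_pos_of_pos hx0 θ
  have hCx : C * x ^ θ ≤ x := by
    calc C * x ^ θ ≤ x ^ (1 - θ) * x ^ θ := by
          gcongr
          exact hB x ((le_max_left _ _).trans hx)
      _ = x := by rw [← Real.rpow_add hx0, sub_add_cancel, Real.rpow_one]
  by_contra! hzero
  obtain ⟨y, hy⟩ : ∃ y : ℝ, y = x + C * x ^ θ := ⟨_, rfl⟩
  rw [← hy] at hzero
  have hxy : x ≤ y := by rw [hy]; linarith [mul_pos hC0 hpow]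
  have hsum : ∑ n ∈ Finset.Icc 1 ⌊x⌋₊, (a n) ^ 2 = ∑ n ∈ Finset.Icc 1 ⌊y⌋₊, (a n) ^ 2 := by
    refine Finset.sum_subset (Finset.Icc_subset_Icc_right (Nat.floor_mono hxy)) fun n hn hn' => ?_
    simp only [Finset.mem_Icc, not_and, not_le] at hn hn'
    have hxn : x < n := Nat.lt_of_floor_lt (hn' hn.1)
    have hny : (n : ℝ) ≤ y := (Nat.le_floor_iff (by linarith)).mp hn.2
    rw [hzero n hxn.le hny]
    norm_num
  have hypow : y ^ θ ≤ 2 * x ^ θ := by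
    calc y ^ θ ≤ (2 * x) ^ θ := Real.rpow_le_rpow (by linarith) (by linarith) hθ0
      _ = 2 ^ θ * x ^ θ := Real.mul_rpow (by norm_num) hx0.le
      _ ≤ 2 * x ^ θ := by
          gcongr
          exact Real.rpow_le_self_of_one_le (by norm_num) hθ1.le
  have h₁ := (abs_le.mp (h x hx2)).2
  have h₂ := (abs_le.mp (h y (hx2.trans hxy))).1
  have hKy : K * y ^ θ ≤ K * (2 * x ^ θ) := by gcongr
  have hcy : c * y = c * x + 4 * K * x ^ θ := by rw [hy, ← hcC]; ring
  linarith [mul_pos hK hpow]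
end

section
/- There exists an absolute constant C > 0 such that for every integer k ≥ 3, every real σ with 1 < σ < 2, and every real t, one has |L_∞(σ + it)| ≤ C · k^{5(2σ−1)} · (1 + t²)^{4(2σ−1)} · |L_∞(1 − σ − it)|. -/
open Filter Topology

noncomputable def GammaR (s : ℂ) : ℂ :=
  (Real.pi : ℂ) ^ (-s / 2) * Complex.Gamma (s / 2)

noncomputable def GammaC (s : ℂ) : ℂ :=
  2 * ((2 * Real.pi : ℝ) : ℂ) ^ (-s) * Complex.Gamma s

noncomputable def Linfty (k : ℕ) (s : ℂ) : ℂ :=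
  (GammaR s * GammaR (s + 1)) ^ 2 *
    (GammaC (s + (k : ℂ) - 1) * GammaC (s + (k : ℂ) - 2)) ^ 2 *
    GammaC (s + 1) * GammaC (s + 2 * (k : ℂ) - 3)

theorem norm_betaIntegral_le (u v : ℂ) :
    ‖Complex.betaIntegral u v‖ ≤ ‖Complex.betaIntegral (u.re : ℂ) (v.re : ℂ)‖ := by
  have key : Complex.betaIntegral (u.re : ℂ) (v.re : ℂ) =
      ((∫ x : ℝ in 0..1, x ^ (u.re - 1) * (1 - x) ^ (v.re - 1) : ℝ) : ℂ) := by
    rw [Complex.betaIntegral, ← intervalIntegral.integral_ofReal]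
    refine intervalIntegral.integral_congr fun x hx => ?_
    rw [Set.uIcc_of_le zero_le_one] at hx
    have h1 : 0 ≤ 1 - x := sub_nonneg.2 hx.2
    simp only [Complex.ofReal_mul]
    rw [Complex.ofReal_cpow hx.1, Complex.ofReal_cpow h1]
    push_cast
    rfl
  rw [key, Complex.norm_real]
  refine le_trans ?_ (le_abs_self _)
  rw [Complex.betaIntegral]
  refine (intervalIntegral.norm_integral_le_integral_norm zero_le_one).trans_eq ?_
  rw [intervalIntegral.integral_of_le zero_le_one, intervalIntegral.integral_of_le zero_le_one,
    MeasureTheory.integral_Ioc_eq_integral_Ioo, MeasureTheory.integral_Ioc_eq_integral_Ioo]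
  refine MeasureTheory.setIntegral_congr_fun measurableSet_Ioo fun x hx => ?_
  have h1 : 0 < 1 - x := sub_pos.2 hx.2
  have h2 : (1 : ℂ) - (x : ℂ) = ((1 - x : ℝ) : ℂ) := by push_cast; rfl
  simp only [norm_mul]
  rw [h2, Complex.norm_cpow_eq_rpow_re_of_pos hx.1, Complex.norm_cpow_eq_rpow_re_of_pos h1]
  simp

theorem Real.rpow_mul_Gamma_le_Gamma_add {x d : ℝ} (hx : 1 < x) (hd : 0 < d) :
    (x - 1) ^ d * Real.Gamma x ≤ Real.Gamma (x + d) := by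
  have h0 : 0 < x - 1 := sub_pos.2 hx
  have hG : 0 < Real.Gamma (x - 1) := Real.Gamma_pos_of_pos h0
  have hGx : 0 < Real.Gamma x := Real.Gamma_pos_of_pos (by linarith)
  have hGd : 0 < Real.Gamma (x + d) := Real.Gamma_pos_of_pos (by linarith)
  have h := Real.convexOn_log_Gamma.slope_mono_adjacent (x := x - 1) (y := x) (z := x + d)
    (Set.mem_Ioi.2 h0) (Set.mem_Ioi.2 (by linarith)) (by linarith) (by linarith)
  have hrec : Real.Gamma x = (x - 1) * Real.Gamma (x - 1) := by
    simpa using Real.Gamma_add_one h0.ne'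
  have hlog : Real.log (Real.Gamma x) = Real.log (x - 1) + Real.log (Real.Gamma (x - 1)) := by
    rw [hrec, Real.log_mul h0.ne' hG.ne']
  simp only [Function.comp, sub_sub_cancel, div_one, add_sub_cancel_left] at h
  rw [le_div_iff₀ hd] at h
  rw [← Real.log_le_log_iff (by positivity) hGd, Real.log_mul (by positivity) hGx.ne',
    Real.log_rpow h0]
  nlinarith

theorem Complex.rpow_mul_norm_Gamma_le {u : ℂ} {d : ℝ} (hu : 1 < u.re) (hd : 0 < d) :
    (u.re - 1) ^ d * ‖Complex.Gamma u‖ ≤ ‖Complex.Gamma (u + d)‖ := by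
  have h1 := Complex.Gamma_mul_Gamma_eq_betaIntegral (s := u) (t := (d : ℂ))
    (by linarith) (by simpa using hd)
  have h2 := Complex.Gamma_mul_Gamma_eq_betaIntegral (s := (u.re : ℂ)) (t := (d : ℂ))
    (by simp; linarith) (by simpa using hd)
  have hb := norm_betaIntegral_le u d
  rw [Complex.ofReal_re] at hb
  have hr := Real.rpow_mul_Gamma_le_Gamma_add hu hd
  have hGd : 0 < Real.Gamma d := Real.Gamma_pos_of_pos hd
  have hGx : 0 < Real.Gamma u.re := Real.Gamma_pos_of_pos (by linarith)
  have hGxd : 0 < Real.Gamma (u.re + d) := Real.Gamma_pos_of_pos (by linarith)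
  apply_fun norm at h1 h2
  rw [← Complex.ofReal_add] at h2
  simp only [norm_mul, Complex.Gamma_ofReal, Complex.norm_real, Real.norm_eq_abs,
    abs_of_pos hGd, abs_of_pos hGx, abs_of_pos hGxd] at h1 h2
  set B := ‖Complex.betaIntegral u d‖
  set B' := ‖Complex.betaIntegral u.re d‖
  have h3 : ‖Complex.Gamma u‖ * Real.Gamma (u.re + d) ≤
      ‖Complex.Gamma (u + d)‖ * Real.Gamma u.re := by
    refine le_of_mul_le_mul_right ?_ hGd
    calc ‖Complex.Gamma u‖ * Real.Gamma (u.re + d) * Real.Gamma d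
        = ‖Complex.Gamma (u + d)‖ * Real.Gamma (u.re + d) * B := by
          linear_combination Real.Gamma (u.re + d) * h1
      _ ≤ ‖Complex.Gamma (u + d)‖ * Real.Gamma (u.re + d) * B' := by gcongr
      _ = _ := by linear_combination -‖Complex.Gamma (u + d)‖ * h2
  refine le_of_mul_le_mul_right ?_ hGx
  calc (u.re - 1) ^ d * ‖Complex.Gamma u‖ * Real.Gamma u.re
      = ‖Complex.Gamma u‖ * ((u.re - 1) ^ d * Real.Gamma u.re) := by ring
    _ ≤ ‖Complex.Gamma u‖ * Real.Gamma (u.re + d) := by gcongr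
    _ ≤ _ := h3

theorem Complex.norm_Gamma_add_le_of_re_pos {w : ℂ} {a : ℝ} (hw : 0 < w.re) (ha : 1 < a)
    (ha' : a < 3) :
    ‖Complex.Gamma (w + a)‖ ≤ (‖w‖ + 2) ^ 3 * w.re ^ (a - 3) * ‖Complex.Gamma w‖ := by
  have h := Complex.rpow_mul_norm_Gamma_le (u := w + a) (d := 3 - a)
    (by simp; linarith) (by linarith)
  have e : w + a + ((3 - a : ℝ) : ℂ) = w + 1 + 1 + 1 := by push_cast; ring
  have n0 : w ≠ 0 := fun h => by simp [h] at hw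
  have n1 : w + 1 ≠ 0 := fun h => by
    have := congrArg Complex.re h
    simp at this; linarith
  have n2 : w + 1 + 1 ≠ 0 := fun h => by
    have := congrArg Complex.re h
    simp at this; linarith
  rw [e, Complex.Gamma_add_one _ n2, Complex.Gamma_add_one _ n1, Complex.Gamma_add_one _ n0,
    norm_mul, norm_mul, norm_mul] at h
  have b1 : ‖w + 1‖ ≤ ‖w‖ + 2 := (norm_add_le _ _).trans (by simp)
  have b2 : ‖w + 1 + 1‖ ≤ ‖w‖ + 2 := by
    rw [add_assoc, one_add_one_eq_two]
    exact (norm_add_le _ _).trans (by simp)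
  have b0 : ‖w‖ ≤ ‖w‖ + 2 := by linarith
  have hp : 0 < w.re ^ (3 - a) := Real.rpow_pos_of_pos hw _
  have hm : w.re ^ (3 - a) ≤ ((w + a).re - 1) ^ (3 - a) :=
    Real.rpow_le_rpow hw.le (by simp; linarith) (by linarith)
  rw [show a - 3 = -(3 - a) by ring, Real.rpow_neg hw.le, mul_right_comm, ← div_eq_mul_inv,
    le_div_iff₀ hp]
  calc ‖Complex.Gamma (w + a)‖ * w.re ^ (3 - a)
      ≤ ‖Complex.Gamma (w + a)‖ * ((w + a).re - 1) ^ (3 - a) := by gcongr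
    _ ≤ ‖w + 1 + 1‖ * (‖w + 1‖ * (‖w‖ * ‖Complex.Gamma w‖)) := by linarith
    _ ≤ (‖w‖ + 2) * ((‖w‖ + 2) * ((‖w‖ + 2) * ‖Complex.Gamma w‖)) := by gcongr
    _ = _ := by ring

theorem Complex.norm_Gamma_add_le_of_shift {w : ℂ} {a M : ℝ} (ha : 0 < a) (hre : -(a / 2) ≤ w.re)
    (hw : ∀ n : ℕ, w + n ≠ 0) (N : ℕ)
    (h : ‖Complex.Gamma (w + N + a)‖ ≤ M * ‖Complex.Gamma (w + N)‖) :
    ‖Complex.Gamma (w + a)‖ ≤ M * ‖Complex.Gamma w‖ := by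
  induction N with
  | zero => simpa using h
  | succ N ih =>
    refine ih ?_
    set z : ℂ := w + N with hz
    have hzre : -(a / 2) ≤ z.re := by
      have : (0 : ℝ) ≤ N := N.cast_nonneg
      simp [hz]; linarith
    have hza : z + a ≠ 0 := fun h0 => by
      have := congrArg Complex.re h0
      simp at this; linarith
    have e1 : w + ((N + 1 : ℕ) : ℂ) = z + 1 := by rw [hz]; push_cast; ring
    have e2 : z + 1 + (a : ℂ) = z + a + 1 := by ring
    rw [e1, e2, Complex.Gamma_add_one _ hza, Complex.Gamma_add_one _ (hw N), norm_mul,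
      norm_mul] at h
    have hle : ‖z‖ ≤ ‖z + a‖ := by
      rw [Complex.norm_def, Complex.norm_def]
      refine Real.sqrt_le_sqrt ?_
      simp only [Complex.normSq_apply, Complex.add_re, Complex.add_im, Complex.ofReal_re,
        Complex.ofReal_im]
      nlinarith
    have hpos : 0 < ‖z + a‖ := norm_pos_iff.2 hza
    have hz0 : 0 < ‖z‖ := norm_pos_iff.2 (hw N)
    have hM : 0 ≤ M * ‖Complex.Gamma z‖ := by
      refine nonneg_of_mul_nonneg_right (a := ‖z‖) ?_ hz0
      calc 0 ≤ ‖z + a‖ * ‖Complex.Gamma (z + a)‖ := by positivity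
        _ ≤ _ := h
        _ = _ := by ring
    refine le_of_mul_le_mul_left (h.trans ?_) hpos
    calc M * (‖z‖ * ‖Complex.Gamma z‖) = ‖z‖ * (M * ‖Complex.Gamma z‖) := by ring
      _ ≤ _ := by gcongr

theorem Complex.norm_Gamma_add_le {w : ℂ} {a X : ℝ} (ha : 1 < a) (ha' : a < 3)
    (hre : -(a / 2) ≤ w.re) (hw : ∀ n : ℕ, w + n ≠ 0) (hX : 1 ≤ X) (hwX : ‖w‖ ≤ X) :
    ‖Complex.Gamma (w + a)‖ ≤ 216 * X ^ a * ‖Complex.Gamma w‖ := by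
  set N := ⌈2 * X⌉₊ with hN
  have hN1 : 2 * X ≤ N := Nat.le_ceil _
  have hN2 : (N : ℝ) < 2 * X + 1 := Nat.ceil_lt_add_one (by linarith)
  refine Complex.norm_Gamma_add_le_of_shift (by linarith) hre hw N ?_
  have habs := (abs_le.1 ((Complex.abs_re_le_norm w).trans hwX)).1
  have hXre : X ≤ (w + N).re := by simp; linarith
  have hX0 : 0 < X := by linarith
  refine (Complex.norm_Gamma_add_le_of_re_pos (by linarith) ha ha').trans ?_
  refine mul_le_mul_of_nonneg_right ?_ (norm_nonneg _)
  have hn : ‖w + N‖ + 2 ≤ 6 * X := by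
    have := norm_add_le w (N : ℂ)
    rw [Complex.norm_natCast] at this
    linarith
  have hp0 : 0 ≤ (w + N).re ^ (a - 3) := Real.rpow_nonneg (by linarith) _
  have hp : (w + N).re ^ (a - 3) ≤ X ^ (a - 3) :=
    Real.rpow_le_rpow_of_nonpos hX0 hXre (by linarith)
  calc (‖w + N‖ + 2) ^ 3 * (w + N).re ^ (a - 3) ≤ (6 * X) ^ 3 * X ^ (a - 3) := by gcongr
    _ = 216 * (X ^ (a - 3) * X ^ (3 : ℝ)) := by
      rw [show (3 : ℝ) = (3 : ℕ) by norm_num, Real.rpow_natCast]; push_cast; ring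
    _ = 216 * X ^ a := by rw [← Real.rpow_add hX0]; ring_nf

theorem norm_GammaC (s : ℂ) :
    ‖GammaC s‖ = 2 * (2 * Real.pi) ^ (-s.re) * ‖Complex.Gamma s‖ := by
  rw [GammaC, norm_mul, norm_mul, Complex.norm_cpow_eq_rpow_re_of_pos Real.two_pi_pos]
  simp

theorem GammaR_mul_GammaR_add_one (s : ℂ) : GammaR s * GammaR (s + 1) = GammaC s := by
  have h := Complex.Gammaℝ_mul_Gammaℝ_add_one s
  rw [Complex.Gammaℝ_def, Complex.Gammaℝ_def, Complex.Gammaℂ_def] at h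
  rw [GammaR, GammaR, GammaC, h]
  push_cast
  rfl

theorem Linfty_eq_GammaC (k : ℕ) (hk : 3 ≤ k) (s : ℂ) :
    Linfty k s = (GammaC (s + (0 : ℕ))) ^ 2 *
      (GammaC (s + (k - 1 : ℕ)) * GammaC (s + (k - 2 : ℕ))) ^ 2 *
      GammaC (s + (1 : ℕ)) * GammaC (s + (2 * k - 3 : ℕ)) := by
  rw [Linfty, GammaR_mul_GammaR_add_one, Nat.cast_sub (by lia), Nat.cast_sub (by lia),
    Nat.cast_sub (by lia)]
  push_cast
  simp only [add_zero, add_sub_assoc]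

theorem norm_GammaC_add_le {σ t Y : ℝ} {m : ℕ} (h1 : 1 < σ) (h2 : σ < 2) (hY : 1 ≤ Y)
    (hm : 1 + m + |t| ≤ 3 * Y) :
    ‖GammaC ((σ : ℂ) + t * Complex.I + m)‖ ≤
      5832 * Y ^ (2 * σ - 1) * ‖GammaC (1 - σ - t * Complex.I + m)‖ := by
  set w : ℂ := ((1 - σ + m : ℝ) : ℂ) + t * Complex.I with hw
  have hwre : w.re = 1 - σ + m := by simp [hw]
  have hconj : (1 - σ - t * Complex.I + m : ℂ) = (starRingEnd ℂ) w := by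
    simp [hw]; ring
  have hadd : (σ : ℂ) + t * Complex.I + m = w + ((2 * σ - 1 : ℝ) : ℂ) := by
    rw [hw]; push_cast; ring
  have hm0 : (0 : ℝ) ≤ m := m.cast_nonneg
  have hne : ∀ n : ℕ, w + n ≠ 0 := fun n h0 => by
    have h := congrArg Complex.re h0
    simp only [Complex.add_re, hwre, Complex.natCast_re, Complex.zero_re] at h
    have e1 : ((0 : ℕ) : ℝ) < ((m + n : ℕ) : ℝ) := by push_cast; linarith
    have e2 : ((m + n : ℕ) : ℝ) < ((1 : ℕ) : ℝ) := by push_cast; linarith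
    rw [Nat.cast_lt] at e1 e2
    lia
  have hnorm : ‖w‖ ≤ 3 * Y := by
    rw [hw]
    refine (norm_add_le _ _).trans ?_
    rw [Complex.norm_real, norm_mul, Complex.norm_I, Complex.norm_real, Real.norm_eq_abs,
      Real.norm_eq_abs, mul_one]
    have : |1 - σ + m| ≤ 1 + m := abs_le.2 ⟨by linarith, by linarith⟩
    linarith
  have key := Complex.norm_Gamma_add_le (w := w) (a := 2 * σ - 1) (X := 3 * Y) (by linarith)
    (by linarith) (by rw [hwre]; linarith) hne (by linarith) hnorm
  have h3 : (3 * Y) ^ (2 * σ - 1) ≤ 27 * Y ^ (2 * σ - 1) := by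
    rw [Real.mul_rpow (by norm_num) (by linarith)]
    gcongr
    calc (3 : ℝ) ^ (2 * σ - 1) ≤ 3 ^ (3 : ℝ) :=
          Real.rpow_le_rpow_of_exponent_le (by norm_num) (by linarith)
      _ = 27 := by norm_num
  rw [norm_GammaC, norm_GammaC, hadd, hconj, Complex.Gamma_conj, Complex.norm_conj,
    Complex.conj_re, Complex.add_re, Complex.ofReal_re]
  have hpi : (2 * Real.pi) ^ (-(w.re + (2 * σ - 1))) ≤ (2 * Real.pi) ^ (-w.re) :=
    Real.rpow_le_rpow_of_exponent_le (by linarith [Real.pi_gt_three]) (by linarith)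
  have hpi0 := Real.two_pi_pos
  calc _ ≤ 2 * (2 * Real.pi) ^ (-w.re) *
        (216 * (27 * Y ^ (2 * σ - 1)) * ‖Complex.Gamma w‖) := by
        gcongr
        exact key.trans (by gcongr)
    _ = _ := by ring

theorem stmt11 :
    ∃ C : ℝ, 0 < C ∧ ∀ (k : ℕ), 3 ≤ k → ∀ σ t : ℝ, 1 < σ → σ < 2 →
      ‖Linfty k ((σ : ℂ) + (t : ℂ) * Complex.I)‖ ≤
        C * (k : ℝ) ^ (5 * (2 * σ - 1)) * (1 + t ^ 2) ^ (4 * (2 * σ - 1)) *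
          ‖Linfty k (1 - (σ : ℂ) - (t : ℂ) * Complex.I)‖ := by
  refine ⟨5832 ^ 8, by positivity, fun k hk σ t h1 h2 => ?_⟩
  set T := √(1 + t ^ 2) with hT
  have hT1 : 1 ≤ T := Real.one_le_sqrt.2 (by nlinarith)
  have htT : |t| ≤ T := Real.abs_le_sqrt (by linarith)
  have hk3 : (3 : ℝ) ≤ k := by exact_mod_cast hk
  have hkT : (k : ℝ) ≤ k * T := le_mul_of_one_le_right (by linarith) hT1
  have hTk : 3 * T ≤ k * T := by gcongr
  have small (m : ℕ) (hm : m ≤ 1) := norm_GammaC_add_le (t := t) (Y := T) (m := m) h1 h2 hT1 (by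
    have : (m : ℝ) ≤ 1 := by exact_mod_cast hm
    linarith)
  have large (m : ℕ) (hm : m + 1 ≤ 2 * k) :=
    norm_GammaC_add_le (t := t) (Y := k * T) (m := m) h1 h2 (by linarith) (by
      have : (m : ℝ) + 1 ≤ 2 * k := by exact_mod_cast hm
      linarith)
  have hkpow : ((k : ℝ) ^ (2 * σ - 1)) ^ 5 = (k : ℝ) ^ (5 * (2 * σ - 1)) := by
    rw [← Real.rpow_mul_natCast (by linarith)]; push_cast; ring_nf
  have hTpow : (T ^ (2 * σ - 1)) ^ 8 = (1 + t ^ 2) ^ (4 * (2 * σ - 1)) := by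
    rw [hT, Real.sqrt_eq_rpow, ← Real.rpow_mul (by positivity),
      ← Real.rpow_mul_natCast (by positivity)]
    push_cast
    ring_nf
  have hmul : (k * T) ^ (2 * σ - 1) = (k : ℝ) ^ (2 * σ - 1) * T ^ (2 * σ - 1) :=
    Real.mul_rpow (by linarith) (by linarith)
  rw [hmul] at large
  rw [← hkpow, ← hTpow, Linfty_eq_GammaC k hk, Linfty_eq_GammaC k hk]
  simp only [norm_mul, norm_pow]
  refine (mul_le_mul (mul_le_mul (mul_le_mul
    (pow_le_pow_left₀ (norm_nonneg _) (small 0 (by lia)) 2)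
    (pow_le_pow_left₀ (by positivity)
      (mul_le_mul (large (k - 1) (by lia)) (large (k - 2) (by lia)) (by positivity)
        (by positivity)) 2) (by positivity) (by positivity))
    (small 1 le_rfl) (by positivity) (by positivity))
    (large (2 * k - 3) (by lia)) (by positivity) (by positivity)).trans_eq ?_
  ring
end

section
/- Let (a_n)_{n≥1} be a sequence of real numbers and c > 0 a real number such that Σ_{n≤x} a_n² = c·x + o(x) as x → ∞ (that is, (1/x)·Σ_{n≤x} a_n² → c). Then there exist infinitely many positive integers n such that |a_n| ≤ √(d(n)), where d(n) denotes the number of positive divisors of n. -/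
open Filter Topology

theorem mul_log_sub_le_sum_card_divisors (N : ℕ) :
    (N : ℝ) * Real.log N - N ≤ ∑ n ∈ Finset.Icc 1 N, (n.divisors.card : ℝ) := by
  have hsum : ∑ n ∈ Finset.Icc 1 N, n.divisors.card = ∑ n ∈ Finset.Icc 1 N, N / n := by
    have hIcc : Finset.Icc 1 N = Finset.Ioc 0 N := by ext; simp; lia
    simpa [hIcc, ArithmeticFunction.sigma_zero_apply] using
      ArithmeticFunction.sum_Ioc_sigma0_eq_sum_div N
  have hlog : Real.log N ≤ ∑ k ∈ Finset.Icc 1 N, (k : ℝ)⁻¹ := by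
    have h := log_add_one_le_harmonic N
    rw [harmonic_eq_sum_Icc] at h
    push_cast at h
    refine le_trans ?_ h
    rcases N.eq_zero_or_pos with rfl | hN
    · simp
    · exact Real.log_le_log (by exact_mod_cast hN) (by linarith)
  calc (N : ℝ) * Real.log N - N
      ≤ N * ∑ k ∈ Finset.Icc 1 N, (k : ℝ)⁻¹ - N := by gcongr
    _ = ∑ k ∈ Finset.Icc 1 N, ((N : ℝ) / k - 1) := by
        simp [Finset.mul_sum, Finset.sum_sub_distrib, div_eq_mul_inv]
    _ ≤ ∑ k ∈ Finset.Icc 1 N, ((N / k : ℕ) : ℝ) := by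
        refine Finset.sum_le_sum fun k _ => ?_
        rw [← Nat.floor_div_eq_div (K := ℝ)]
        exact (Nat.sub_one_lt_floor _).le
    _ = ∑ n ∈ Finset.Icc 1 N, (n.divisors.card : ℝ) := by exact_mod_cast hsum.symm

theorem stmt13 (a : ℕ → ℝ) (c : ℝ) (hc : 0 < c)
    (h : Tendsto (fun x : ℝ => (∑ n ∈ Finset.Icc 1 ⌊x⌋₊, (a n) ^ 2) / x)
      atTop (nhds c)) :
    {n : ℕ | 0 < n ∧ |a n| ≤ Real.sqrt (n.divisors.card : ℝ)}.Infinite := by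
  intro hfin
  set D : ℝ := ∑ n ∈ hfin.toFinset, (n.divisors.card : ℝ)
  have hD : 0 ≤ D := by positivity
  have hbound (N : ℕ) : ∑ n ∈ Finset.Icc 1 N, (n.divisors.card : ℝ) ≤
      ∑ n ∈ Finset.Icc 1 N, a n ^ 2 + D := by
    rw [← Finset.sum_filter_add_sum_filter_not (Finset.Icc 1 N) (· ∉ hfin.toFinset)]
    refine add_le_add ?_ ?_
    · refine (Finset.sum_le_sum fun n hn => ?_).trans
        (Finset.sum_le_sum_of_subset_of_nonneg (Finset.filter_subset _ _)
          fun n _ _ => sq_nonneg (a n))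
      simp only [Finset.mem_filter, Finset.mem_Icc, Set.Finite.mem_toFinset,
        Set.mem_ofPred_eq, not_and, not_le] at hn
      have hlt := hn.2 hn.1.1
      rw [Real.sqrt_lt' ((Real.sqrt_nonneg _).trans_lt hlt), sq_abs] at hlt
      exact hlt.le
    · refine Finset.sum_le_sum_of_subset_of_nonneg (fun n hn => ?_)
        fun n _ _ => Nat.cast_nonneg _
      simpa only [not_not] using (Finset.mem_filter.1 hn).2
  have hmean := (h.comp tendsto_natCast_atTop_atTop).eventually (gt_mem_nhds (lt_add_one c))
  have hlog := (Real.tendsto_log_atTop.comp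
    (tendsto_natCast_atTop_atTop (R := ℝ))).eventually_ge_atTop (c + 2 + D)
  obtain ⟨N, hN, hN', hpos⟩ := (hmean.and (hlog.and (eventually_ge_atTop 1))).exists
  have hN1 : (1 : ℝ) ≤ N := by exact_mod_cast hpos
  simp only [Function.comp_apply, Nat.floor_natCast] at hN hN'
  rw [div_lt_iff₀ (by linarith)] at hN
  have hlower := mul_log_sub_le_sum_card_divisors N
  have hupper := hbound N
  have hmul := mul_le_mul_of_nonneg_left hN' (by linarith : (0 : ℝ) ≤ N)
  have hDN := mul_le_mul_of_nonneg_right hN1 hD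
  linarith
end
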